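/- Let f : ℝⁿ → ℝ be twice differentiable with ∇²f Lipschitz with constant L₂, and c = (c_1,…,c_m) : ℝⁿ → ℝᵐ twice differentiable with each ∇²c_i Lipschitz with constant Γ_{2,i}, Γ₂ := ∑_i Γ_{2,i}. Let τ > 0, η ∈ (0,1), κ_l > 0, γ₀ > 0, and x, d ∈ ℝⁿ with ∇c(x)ᵀ d = −c(x) and ‖d‖ ≤ γ₀. Let ḡ ∈ ℝⁿ, Δl := −τ ḡᵀd + ‖c(x)‖₁ with Δl ≥ κ_l τ ‖d‖². Let H̄ be an n×n matrix with ‖H̄ − ∇²f(x)‖ ≤ ε̄_H in operator norm, where 0 ≤ ε̄_H < 2(1 − η) κ_l. Let f̄ and ε_f, ε_A ≥ 0 satisfy |f̄(x) − f(x)| ≤ ε_f, |f̄(x + α d) − f(x + α d)| ≤ ε_f, and ε_A ≥ τ ‖∇f(x) − ḡ‖ ‖d‖ + 2 τ ε_f. Then for every α with 0 < α ≤ min{1, √( τ (6 κ_l (1 − η) − 3 ε̄_H) / ((τ L₂ + Γ₂) γ₀) )}, the modified line search condition holds: τ f̄(x + α d) + ‖c(x + α d)‖₁ ≤ τ f̄(x)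 + ‖c(x)‖₁ − η α Δl + (α²/2) τ dᵀ H̄ d + (α²/2) ∑_{i=1}^m |dᵀ∇²c_i(x)d| + ε_A. -/

import Mathlib

open Finset RealInnerProductSpace

theorem le_cubic_taylor_of_second_deriv_le {φ φ₁ φ₂ : ℝ → ℝ} {M : ℝ}
    (h₁ : ∀ t, HasDerivAt φ (φ₁ t) t) (h₂ : ∀ t, HasDerivAt φ₁ (φ₂ t) t)
    (hM : ∀ t, 0 ≤ t → φ₂ t ≤ φ₂ 0 + M * t) {t : ℝ} (ht : 0 ≤ t) :
    φ t ≤ φ 0 + φ₁ 0 * t + φ₂ 0 / 2 * t ^ 2 + M / 6 * t ^ 3 := by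
  have antitone_of_nonpos : ∀ {g g' : ℝ → ℝ}, (∀ s, HasDerivAt g (g' s) s) →
      (∀ s, 0 ≤ s → g' s ≤ 0) → ∀ s, 0 ≤ s → g s ≤ g 0 := by
    intro g g' hg hg' s hs
    refine antitoneOn_of_deriv_nonpos (convex_Ici (0 : ℝ))
      (fun u _ => (hg u).continuousAt.continuousWithinAt)
      (fun u _ => (hg u).differentiableAt.differentiableWithinAt) ?_
      Set.self_mem_Ici hs hs
    intro u hu
    rw [(hg u).deriv]
    exact hg' u (interior_subset hu)
  have first : ∀ s, 0 ≤ s → φ₁ s - (φ₂ 0 * s + M / 2 * s ^ 2) ≤ φ₁ 0 := by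
    intro s hs
    have key := antitone_of_nonpos (g := fun s => φ₁ s - (φ₂ 0 * s + M / 2 * s ^ 2))
      (g' := fun s => φ₂ s - (φ₂ 0 + M * s)) (fun u => by
        refine ((h₂ u).sub (((hasDerivAt_id u).const_mul (φ₂ 0)).add
          ((hasDerivAt_pow 2 u).const_mul (M / 2)))).congr_deriv ?_
        norm_num
        ring) (fun u hu => by linarith [hM u hu]) s hs
    simpa using key
  have key := antitone_of_nonpos
    (g := fun s => φ s - (φ₁ 0 * s + φ₂ 0 / 2 * s ^ 2 + M / 6 * s ^ 3))
    (g' := fun s => φ₁ s - (φ₁ 0 + φ₂ 0 * s + M / 2 * s ^ 2)) (fun u => by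
      refine ((h₁ u).sub ((((hasDerivAt_id u).const_mul (φ₁ 0)).add
        ((hasDerivAt_pow 2 u).const_mul (φ₂ 0 / 2))).add
        ((hasDerivAt_pow 3 u).const_mul (M / 6)))).congr_deriv ?_
      norm_num
      ring) (fun u hu => by linarith [first u hu]) t ht
  norm_num at key
  linarith

theorem abs_sub_quadratic_taylor_le {E : Type*} [NormedAddCommGroup E] [NormedSpace ℝ E]
    {g : E → ℝ} {L : ℝ} (hg : Differentiable ℝ g) (hg₂ : Differentiable ℝ (fderiv ℝ g))
    (hL : ∀ a b, ‖fderiv ℝ (fderiv ℝ g) a - fderiv ℝ (fderiv ℝ g) b‖ ≤ L * ‖a - b‖)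
    (x d : E) {t : ℝ} (ht : 0 ≤ t) :
    |g (x + t • d) - (g x + t * fderiv ℝ g x d + t ^ 2 / 2 * fderiv ℝ (fderiv ℝ g) x d d)| ≤
      L * ‖d‖ ^ 3 / 6 * t ^ 3 := by
  have hline : ∀ s : ℝ, HasDerivAt (fun s : ℝ => x + s • d) d s := fun s => by
    simpa using ((hasDerivAt_id s).smul_const d).const_add x
  have h₁ : ∀ s : ℝ, HasDerivAt (fun s : ℝ => g (x + s • d)) (fderiv ℝ g (x + s • d) d) s :=
    fun s => (hg _).hasFDerivAt.comp_hasDerivAt s (hline s)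
  have h₂ : ∀ s : ℝ, HasDerivAt (fun s : ℝ => fderiv ℝ g (x + s • d) d)
      (fderiv ℝ (fderiv ℝ g) (x + s • d) d d) s := fun s => by
    have h := ((hg₂ _).hasFDerivAt.comp_hasDerivAt s (hline s)).clm_apply (hasDerivAt_const s d)
    simpa using h
  have hbound : ∀ s : ℝ, 0 ≤ s →
      |fderiv ℝ (fderiv ℝ g) (x + s • d) d d - fderiv ℝ (fderiv ℝ g) x d d| ≤
        L * ‖d‖ ^ 3 * s := by
    intro s hs
    calc |fderiv ℝ (fderiv ℝ g) (x + s • d) d d - fderiv ℝ (fderiv ℝ g) x d d|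
        = ‖(fderiv ℝ (fderiv ℝ g) (x + s • d) - fderiv ℝ (fderiv ℝ g) x) d d‖ := by
          simp
      _ ≤ ‖fderiv ℝ (fderiv ℝ g) (x + s • d) - fderiv ℝ (fderiv ℝ g) x‖ * ‖d‖ * ‖d‖ :=
          ContinuousLinearMap.le_opNorm₂ _ _ _
      _ ≤ L * ‖x + s • d - x‖ * ‖d‖ * ‖d‖ := by gcongr; exact hL _ _
      _ = L * ‖d‖ ^ 3 * s := by
          rw [add_sub_cancel_left, norm_smul, Real.norm_of_nonneg hs]
          ring
  have upper := le_cubic_taylor_of_second_deriv_le h₁ h₂ (M := L * ‖d‖ ^ 3) (fun s hs => by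
    have := (abs_le.1 (hbound s hs)).2
    simp only [zero_smul, add_zero]
    linarith) ht
  have lower := le_cubic_taylor_of_second_deriv_le (fun s => (h₁ s).neg) (fun s => (h₂ s).neg)
    (M := L * ‖d‖ ^ 3) (fun s hs => by
      have := (abs_le.1 (hbound s hs)).1
      simp only [zero_smul, add_zero]
      linarith) ht
  simp only [zero_smul, add_zero, Pi.neg_apply] at upper lower
  rw [abs_le]
  constructor <;> linarith

theorem stmt_11 (n m : ℕ)
    (f : EuclideanSpace ℝ (Fin n) → ℝ)
    (hfd : Differentiable ℝ f) (hfd2 : Differentiable ℝ (fderiv ℝ f))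
    (L₂ : ℝ)
    (hfLip : ∀ a b, ‖fderiv ℝ (fderiv ℝ f) a - fderiv ℝ (fderiv ℝ f) b‖ ≤ L₂ * ‖a - b‖)
    (c : Fin m → EuclideanSpace ℝ (Fin n) → ℝ)
    (hcd : ∀ i, Differentiable ℝ (c i)) (hcd2 : ∀ i, Differentiable ℝ (fderiv ℝ (c i)))
    (Γ₂i : Fin m → ℝ)
    (hcLip : ∀ i, ∀ a b,
      ‖fderiv ℝ (fderiv ℝ (c i)) a - fderiv ℝ (fderiv ℝ (c i)) b‖ ≤ Γ₂i i * ‖a - b‖)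
    (τ η κl γ₀ : ℝ) (hτ : 0 < τ) (hη : η ∈ Set.Ioo (0 : ℝ) 1) (hκl : 0 < κl) (hγ₀ : 0 < γ₀)
    (x d : EuclideanSpace ℝ (Fin n))
    (hlin : ∀ i, fderiv ℝ (c i) x d = -(c i x)) (hdγ : ‖d‖ ≤ γ₀)
    (gbar : EuclideanSpace ℝ (Fin n))
    (Δl : ℝ) (hΔl : Δl = -(τ * ⟪gbar, d⟫) + ∑ i, |c i x|)
    (hΔllb : κl * τ * ‖d‖ ^ 2 ≤ Δl)
    (Hbar : EuclideanSpace ℝ (Fin n) →L[ℝ] EuclideanSpace ℝ (Fin n) →L[ℝ] ℝ)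
    (εbarH : ℝ) (hεH0 : 0 ≤ εbarH) (hεHlt : εbarH < 2 * (1 - η) * κl)
    (hHbar : ‖Hbar - fderiv ℝ (fderiv ℝ f) x‖ ≤ εbarH)
    (fbar : EuclideanSpace ℝ (Fin n) → ℝ) (εf εA : ℝ) (hεf : 0 ≤ εf) (hεA0 : 0 ≤ εA)
    (hfbar0 : |fbar x - f x| ≤ εf)
    (hεAge : τ * ‖gradient f x - gbar‖ * ‖d‖ + 2 * τ * εf ≤ εA) :
    ∀ α : ℝ, 0 < α →
      α ≤ min 1
        (Real.sqrt (τ * (6 * κl * (1 - η) - 3 * εbarH) / ((τ * L₂ + ∑ i, Γ₂i i) * γ₀))) →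
      |fbar (x + α • d) - f (x + α • d)| ≤ εf →
      τ * fbar (x + α • d) + ∑ i, |c i (x + α • d)| ≤
        τ * fbar x + ∑ i, |c i x| - η * α * Δl
          + (α ^ 2 / 2) * (τ * Hbar d d)
          + (α ^ 2 / 2) * ∑ i, |fderiv ℝ (fderiv ℝ (c i)) x d d|
          + εA := by
  intro α hα hαmin hfbar1
  obtain ⟨hα1, hαsqrt⟩ := le_min_iff.1 hαmin
  set Γ₂ := ∑ i, Γ₂i i
  set D := ‖d‖
  have hD0 : 0 ≤ D := norm_nonneg d
  have hη1 : η < 1 := hη.2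
  have hnum : 0 < τ * (6 * κl * (1 - η) - 3 * εbarH) := mul_pos hτ (by linarith)
  have hquot : 0 < τ * (6 * κl * (1 - η) - 3 * εbarH) / ((τ * L₂ + Γ₂) * γ₀) :=
    Real.sqrt_pos.1 (hα.trans_le hαsqrt)
  have hden : 0 < (τ * L₂ + Γ₂) * γ₀ := (div_pos_iff_of_pos_left hnum).1 hquot
  have hK : 0 < τ * L₂ + Γ₂ := pos_of_mul_pos_left hden hγ₀.le
  have hαsq : α ^ 2 * ((τ * L₂ + Γ₂) * γ₀) ≤ τ * (6 * κl * (1 - η) - 3 * εbarH) :=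
    (le_div_iff₀ hden).1 ((Real.le_sqrt hα.le hquot.le).1 hαsqrt)
  have hf := (abs_le.1 (abs_sub_quadratic_taylor_le hfd hfd2 hfLip x d hα.le)).2
  have hc : ∀ i, |c i (x + α • d)| ≤ (1 - α) * |c i x|
      + α ^ 2 / 2 * |fderiv ℝ (fderiv ℝ (c i)) x d d| + Γ₂i i * (D ^ 3 / 6 * α ^ 3) := by
    intro i
    have h := abs_sub_quadratic_taylor_le (hcd i) (hcd2 i) (hcLip i) x d hα.le
    rw [hlin i] at h
    have hsplit := abs_add_three
      (c i (x + α • d) - (c i x + α * -(c i x) + α ^ 2 / 2 * fderiv ℝ (fderiv ℝ (c i)) x d d))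
      ((1 - α) * c i x) (α ^ 2 / 2 * fderiv ℝ (fderiv ℝ (c i)) x d d)
    rw [abs_mul (1 - α), abs_mul (α ^ 2 / 2), abs_of_nonneg (sub_nonneg.2 hα1),
      abs_of_nonneg (by positivity : 0 ≤ α ^ 2 / 2)] at hsplit
    have hsum : c i (x + α • d) - (c i x + α * -(c i x)
        + α ^ 2 / 2 * fderiv ℝ (fderiv ℝ (c i)) x d d) + (1 - α) * c i x
        + α ^ 2 / 2 * fderiv ℝ (fderiv ℝ (c i)) x d d = c i (x + α • d) := by ring
    rw [hsum] at hsplit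
    linarith
  have hcsum : ∑ i, |c i (x + α • d)| ≤ (1 - α) * ∑ i, |c i x|
      + α ^ 2 / 2 * ∑ i, |fderiv ℝ (fderiv ℝ (c i)) x d d| + Γ₂ * (D ^ 3 / 6 * α ^ 3) := by
    calc _ ≤ _ := Finset.sum_le_sum fun i _ => hc i
      _ = _ := by simp only [Finset.sum_add_distrib, ← Finset.mul_sum, ← Finset.sum_mul, Γ₂]
  have hgrad : fderiv ℝ f x d - ⟪gbar, d⟫ ≤ ‖gradient f x - gbar‖ * D := by
    have h : ⟪gradient f x, d⟫ = fderiv ℝ f x d := by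
      simp [gradient]
    rw [← h, ← inner_sub_left]
    exact real_inner_le_norm _ _
  have hgradα : α * (τ * (fderiv ℝ f x d - ⟪gbar, d⟫)) ≤ τ * ‖gradient f x - gbar‖ * D := by
    have hnn : 0 ≤ τ * ‖gradient f x - gbar‖ * D := by positivity
    calc α * (τ * (fderiv ℝ f x d - ⟪gbar, d⟫))
        ≤ α * (τ * (‖gradient f x - gbar‖ * D)) := by gcongr
      _ = α * (τ * ‖gradient f x - gbar‖ * D) := by ring
      _ ≤ _ := mul_le_of_le_one_left hnn hα1
  have hH : fderiv ℝ (fderiv ℝ f) x d d - Hbar d d ≤ εbarH * D ^ 2 := by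
    calc fderiv ℝ (fderiv ℝ f) x d d - Hbar d d
        = -((Hbar - fderiv ℝ (fderiv ℝ f) x) d d) := by simp
      _ ≤ ‖(Hbar - fderiv ℝ (fderiv ℝ f) x) d d‖ := neg_le_abs _
      _ ≤ ‖Hbar - fderiv ℝ (fderiv ℝ f) x‖ * D * D := ContinuousLinearMap.le_opNorm₂ _ _ _
      _ ≤ εbarH * D * D := by gcongr
      _ = εbarH * D ^ 2 := by ring
  have hHα : α ^ 2 / 2 * (τ * (fderiv ℝ (fderiv ℝ f) x d d - Hbar d d)) ≤
      α * (τ * (εbarH * D ^ 2) / 2) := by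
    have hnn : 0 ≤ τ * (εbarH * D ^ 2) / 2 := by positivity
    calc α ^ 2 / 2 * (τ * (fderiv ℝ (fderiv ℝ f) x d d - Hbar d d))
        ≤ α ^ 2 / 2 * (τ * (εbarH * D ^ 2)) := by gcongr
      _ = α * (α * (τ * (εbarH * D ^ 2) / 2)) := by ring
      _ ≤ _ := by gcongr; exact mul_le_of_le_one_left hnn hα1
  have hcubic : (τ * L₂ + Γ₂) * (D ^ 3 / 6 * α ^ 3) ≤
      α * (D ^ 2 * (τ * (6 * κl * (1 - η) - 3 * εbarH)) / 6) := by
    calc (τ * L₂ + Γ₂) * (D ^ 3 / 6 * α ^ 3)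
        = α * (D ^ 2 * (α ^ 2 * ((τ * L₂ + Γ₂) * D)) / 6) := by ring
      _ ≤ α * (D ^ 2 * (α ^ 2 * ((τ * L₂ + Γ₂) * γ₀)) / 6) := by gcongr
      _ ≤ _ := by gcongr
  have hred : α * ((1 - η) * (κl * τ * D ^ 2)) ≤ α * ((1 - η) * Δl) := by
    have := sub_nonneg.2 hη1.le
    gcongr
  have hfτ := mul_le_mul_of_nonneg_left hf hτ.le
  have hτ0 := mul_le_mul_of_nonneg_left (abs_le.1 hfbar0).1 hτ.le
  have hτ1 := mul_le_mul_of_nonneg_left (abs_le.1 hfbar1).2 hτ.le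
  have hαΔ : α * Δl = -(α * (τ * ⟪gbar, d⟫)) + α * ∑ i, |c i x| := by rw [hΔl]; ring
  nlinarith only [hfτ, hτ0, hτ1, hαΔ, hred, hcubic, hHα, hgradα, hcsum, hεAge]
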